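/- arXiv:2602.05906 — 2 statements merged into one kernel-verified Lean document; each statement's English description precedes it below -/
import Mathlib

section
/- For every integer n ≥ 0 and every t in the open interval (nτ, (n+1)τ), the second derivative of S_τ^{a,b} exists at t and satisfies the homogeneous delay differential equation (d²/dt²)S_τ^{a,b}(t) = a·S_τ^{a,b}(t) + b·S_τ^{a,b}(t-τ), where S_τ^{a,b}(s) = 0 for s < 0 by convention. -/
/-- Single term of the double series defining the delayed perturbation cosine function. -/
noncomputable def Cterm (τ a b t : ℝ) (k m : ℕ) : ℝ :=
  if k ≤ m then
    (m.choose k : ℝ) * a ^ (m - k) * b ^ k * (max (t - (k : ℝ) * τ) 0) ^ (2 * m) /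
      (Nat.factorial (2 * m) : ℝ)
  else 0

/-- Single term of the double series defining the delayed perturbation sine function. -/
noncomputable def Sterm (τ a b t : ℝ) (k m : ℕ) : ℝ :=
  if k ≤ m then
    (m.choose k : ℝ) * a ^ (m - k) * b ^ k * (max (t - (k : ℝ) * τ) 0) ^ (2 * m + 1) /
      (Nat.factorial (2 * m + 1) : ℝ)
  else 0

/-- The delayed perturbation cosine-type function `C_τ^{a,b}`, extended by `0` for `t < 0`. -/
noncomputable def Cdel (τ a b : ℝ) (t : ℝ) : ℝ :=
  if t < 0 then 0 else ∑' k : ℕ, ∑' m : ℕ, Cterm τ a b t k m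

/-- The delayed perturbation sine-type function `S_τ^{a,b}`, extended by `0` for `t < 0`. -/
noncomputable def Sdel (τ a b : ℝ) (t : ℝ) : ℝ :=
  if t < 0 then 0 else ∑' k : ℕ, ∑' m : ℕ, Sterm τ a b t k m

/-- Coefficient of the `m`-th power in the `k`-th series of the delayed perturbation functions. -/
noncomputable def delCoeff (a b : ℝ) (k m : ℕ) : ℝ :=
  (m.choose k : ℝ) * a ^ (m - k) * b ^ k

/-- The undelayed `k`-th series of the delayed perturbation sine. -/
noncomputable def oddSeries (a b : ℝ) (k : ℕ) (x : ℝ) : ℝ :=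
  ∑' m : ℕ, delCoeff a b k m * (x ^ (2 * m + 1) / (Nat.factorial (2 * m + 1) : ℝ))

/-- The undelayed `k`-th series of the delayed perturbation cosine. -/
noncomputable def evenSeries (a b : ℝ) (k : ℕ) (x : ℝ) : ℝ :=
  ∑' m : ℕ, delCoeff a b k m * (x ^ (2 * m) / (Nat.factorial (2 * m) : ℝ))

theorem abs_delCoeff_le (a b : ℝ) (k m : ℕ) : |delCoeff a b k m| ≤ (|a| + |b| + 1) ^ m := by
  rcases lt_or_ge m k with h | h
  · rw [delCoeff, Nat.choose_eq_zero_of_lt h]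
    simp only [Nat.cast_zero, zero_mul, abs_zero]
    positivity
  · calc |delCoeff a b k m| = |b| ^ k * |a| ^ (m - k) * (m.choose k : ℝ) := by
          rw [delCoeff, abs_mul, abs_mul, abs_pow, abs_pow, Nat.abs_cast]; ring
      _ ≤ ∑ i ∈ Finset.range (m + 1), |b| ^ i * |a| ^ (m - i) * (m.choose i : ℝ) :=
          Finset.single_le_sum (f := fun i => |b| ^ i * |a| ^ (m - i) * (m.choose i : ℝ))
            (fun i _ => by positivity) (Finset.mem_range.2 (by omega))
      _ = (|b| + |a|) ^ m := (add_pow _ _ _).symm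
      _ ≤ (|a| + |b| + 1) ^ m := pow_le_pow_left₀ (by positivity) (by linarith) m

theorem delCoeff_succ_succ (a b : ℝ) (k m : ℕ) :
    delCoeff a b (k + 1) (m + 1) = a * delCoeff a b (k + 1) m + b * delCoeff a b k m := by
  simp only [delCoeff, Nat.choose_succ_succ, Nat.add_sub_add_right]
  rcases lt_or_ge m (k + 1) with h | h
  · rw [Nat.choose_eq_zero_of_lt h]
    push_cast
    ring
  · obtain ⟨j, rfl⟩ := Nat.exists_eq_add_of_le h
    rw [show k + 1 + j - k = j + 1 by omega, show k + 1 + j - (k + 1) = j by omega]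
    push_cast
    ring

theorem delCoeff_zero_succ (a b : ℝ) (m : ℕ) :
    delCoeff a b 0 (m + 1) = a * delCoeff a b 0 m := by
  simp [delCoeff, pow_succ, mul_comm]

theorem summable_mul_pow_div_factorial {c : ℕ → ℝ} {e : ℕ → ℕ} {Q : ℝ}
    (he : Function.Injective e) (hc : ∀ m, |c m| ≤ Q ^ e m) (r : ℝ) :
    Summable fun m => |c m| * (|r| ^ e m / (Nat.factorial (e m) : ℝ)) := by
  refine Summable.of_nonneg_of_le (fun m => by positivity) (fun m => ?_)
    ((Real.summable_pow_div_factorial (Q * |r|)).comp_injective he)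
  calc |c m| * (|r| ^ e m / (Nat.factorial (e m) : ℝ))
      ≤ Q ^ e m * (|r| ^ e m / (Nat.factorial (e m) : ℝ)) := by gcongr; exact hc m
    _ = _ := by simp only [Function.comp, mul_pow, mul_div_assoc]

theorem hasDerivAt_tsum_mul_pow_div_factorial {c : ℕ → ℝ} {e : ℕ → ℕ} {Q : ℝ}
    (he : Function.Injective e) (hc : ∀ m, |c m| ≤ Q ^ e m) (x : ℝ) :
    HasDerivAt (fun y => ∑' m, c m * (y ^ (e m + 1) / (Nat.factorial (e m + 1) : ℝ)))
      (∑' m, c m * (x ^ e m / (Nat.factorial (e m) : ℝ))) x := by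
  have hr : (0 : ℝ) < |x| + 1 := by positivity
  refine hasDerivAt_tsum_of_isPreconnected
    (summable_mul_pow_div_factorial he hc (|x| + 1)) (t := Metric.ball 0 (|x| + 1))
    (g := fun m y => c m * (y ^ (e m + 1) / (Nat.factorial (e m + 1) : ℝ)))
    (g' := fun m y => c m * (y ^ e m / (Nat.factorial (e m) : ℝ))) (y₀ := 0)
    Metric.isOpen_ball (convex_ball 0 _).isPreconnected ?_ ?_ (by simpa using hr) ?_ (by simp)
  · intro m y _
    have h := ((hasDerivAt_pow (e m + 1) y).div_const
      (Nat.factorial (e m + 1) : ℝ)).const_mul (c m)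
    refine h.congr_deriv ?_
    rw [Nat.factorial_succ]
    have : (Nat.factorial (e m) : ℝ) ≠ 0 := by positivity
    push_cast
    have : (e m : ℝ) + 1 ≠ 0 := by positivity
    field_simp
  · intro m y hy
    have hy' : |y| ≤ |(|x| + 1)| := by
      rw [abs_of_pos hr]
      simpa using (mem_ball_zero_iff.1 hy).le
    rw [Real.norm_eq_abs, abs_mul, abs_div, abs_pow, Nat.abs_cast]
    gcongr
  · simp

theorem abs_delCoeff_le_pow {a b : ℝ} (k : ℕ) {m j : ℕ} (h : m ≤ j) :
    |delCoeff a b k m| ≤ (|a| + |b| + 1) ^ j :=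
  (abs_delCoeff_le a b k m).trans
    (pow_le_pow_right₀ (by linarith [abs_nonneg a, abs_nonneg b]) h)

theorem summable_oddSeries (a b : ℝ) (k : ℕ) (x : ℝ) :
    Summable fun m : ℕ =>
      delCoeff a b k m * (x ^ (2 * m + 1) / (Nat.factorial (2 * m + 1) : ℝ)) := by
  refine Summable.of_norm ?_
  simpa [abs_mul, abs_div] using
    summable_mul_pow_div_factorial (c := delCoeff a b k) (e := fun m => 2 * m + 1)
      (fun i j h => by simpa using h) (fun m => abs_delCoeff_le_pow k (by omega)) x

theorem summable_evenSeries (a b : ℝ) (k : ℕ) (x : ℝ) :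
    Summable fun m : ℕ => delCoeff a b k m * (x ^ (2 * m) / (Nat.factorial (2 * m) : ℝ)) := by
  refine Summable.of_norm ?_
  simpa [abs_mul, abs_div] using
    summable_mul_pow_div_factorial (c := delCoeff a b k) (e := fun m => 2 * m)
      (fun i j h => by simpa using h) (fun m => abs_delCoeff_le_pow k (by omega)) x

theorem hasDerivAt_oddSeries (a b : ℝ) (k : ℕ) (x : ℝ) :
    HasDerivAt (oddSeries a b k) (evenSeries a b k x) x :=
  hasDerivAt_tsum_mul_pow_div_factorial (c := delCoeff a b k) (e := fun m => 2 * m)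
    (fun i j h => by simpa using h) (fun m => abs_delCoeff_le_pow k (by omega)) x

theorem hasDerivAt_evenSeries_tsum (a b : ℝ) (k : ℕ) (x : ℝ) :
    HasDerivAt (evenSeries a b k)
      (∑' m : ℕ, delCoeff a b k (m + 1) *
        (x ^ (2 * m + 1) / (Nat.factorial (2 * m + 1) : ℝ))) x := by
  have h := hasDerivAt_tsum_mul_pow_div_factorial (c := fun m => delCoeff a b k (m + 1))
    (e := fun m => 2 * m + 1) (fun i j h => by simpa using h)
    (fun m => abs_delCoeff_le_pow k (by omega)) x
  refine (h.const_add (delCoeff a b k 0)).congr_of_eventuallyEq (.of_forall fun y => ?_)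
  rw [evenSeries, (summable_evenSeries a b k y).tsum_eq_zero_add]
  simp [mul_add]

theorem hasDerivAt_evenSeries_zero (a b x : ℝ) :
    HasDerivAt (evenSeries a b 0) (a * oddSeries a b 0 x) x := by
  convert hasDerivAt_evenSeries_tsum a b 0 x using 1
  simp_rw [delCoeff_zero_succ, mul_assoc]
  rw [tsum_mul_left, oddSeries]

theorem hasDerivAt_evenSeries_succ (a b : ℝ) (k : ℕ) (x : ℝ) :
    HasDerivAt (evenSeries a b (k + 1))
      (a * oddSeries a b (k + 1) x + b * oddSeries a b k x) x := by
  convert hasDerivAt_evenSeries_tsum a b (k + 1) x using 1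
  simp_rw [delCoeff_succ_succ, add_mul, mul_assoc]
  rw [((summable_oddSeries a b (k + 1) x).mul_left a).tsum_add
    ((summable_oddSeries a b k x).mul_left b), tsum_mul_left, tsum_mul_left, oddSeries, oddSeries]

theorem tsum_Sterm (τ a b t : ℝ) (k : ℕ) :
    ∑' m, Sterm τ a b t k m = oddSeries a b k (max (t - k * τ) 0) := by
  refine tsum_congr fun m => ?_
  rw [Sterm, delCoeff]
  split_ifs with h
  · rw [mul_div_assoc]
  · simp [Nat.choose_eq_zero_of_lt (not_le.1 h)]

theorem oddSeries_zero_right (a b : ℝ) (k : ℕ) : oddSeries a b k 0 = 0 := by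
  simp [oddSeries]

/-- On `[(n - 1)τ, nτ]` only the first `n` series contribute to the delayed sine. -/
theorem Sdel_eq_sum {τ : ℝ} (hτ : 0 < τ) (a b : ℝ) (n : ℕ) {t : ℝ}
    (h₁ : ((n : ℝ) - 1) * τ ≤ t) (h₂ : t < n * τ) :
    Sdel τ a b t = ∑ k ∈ Finset.range n, oddSeries a b k (t - k * τ) := by
  rw [Sdel]
  split_ifs with h
  · have : n = 0 := by
      by_contra hn
      have : (1 : ℝ) ≤ n := by exact_mod_cast Nat.one_le_iff_ne_zero.2 hn
      nlinarith
    simp [this]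
  · simp_rw [tsum_Sterm]
    rw [tsum_eq_sum (s := Finset.range n)]
    · refine Finset.sum_congr rfl fun k hk => ?_
      have : (k : ℝ) + 1 ≤ n := by exact_mod_cast Finset.mem_range.1 hk
      rw [max_eq_left (by nlinarith)]
    · intro k hk
      have : (n : ℝ) ≤ k := by exact_mod_cast not_lt.1 (Finset.mem_range.not.1 hk)
      rw [max_eq_right (by nlinarith), oddSeries_zero_right]

theorem hasDerivAt_Sdel {τ : ℝ} (hτ : 0 < τ) (a b : ℝ) (n : ℕ) {t : ℝ}
    (ht : t ∈ Set.Ioo ((n : ℝ) * τ) (((n : ℝ) + 1) * τ)) :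
    HasDerivAt (Sdel τ a b)
      (∑ k ∈ Finset.range (n + 1), evenSeries a b k (t - k * τ)) t := by
  have h : HasDerivAt (fun s => ∑ k ∈ Finset.range (n + 1), oddSeries a b k (s - k * τ))
      (∑ k ∈ Finset.range (n + 1), evenSeries a b k (t - k * τ)) t :=
    HasDerivAt.fun_sum fun k _ => (hasDerivAt_oddSeries a b k _).comp_sub_const t (k * τ)
  refine h.congr_of_eventuallyEq ?_
  filter_upwards [isOpen_Ioo.mem_nhds ht] with s hs
  exact Sdel_eq_sum hτ a b (n + 1) (by push_cast; linarith [hs.1]) (by push_cast; exact hs.2)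

/-- for every integer `n ≥ 0` and `t ∈ (nτ, (n+1)τ)`, the second derivative
of `S_τ^{a,b}` exists at `t` and satisfies the homogeneous delay differential equation
`(S_τ^{a,b})''(t) = a·S_τ^{a,b}(t) + b·S_τ^{a,b}(t-τ)` (with the extension-by-zero
convention for negative arguments built into `Sdel`). -/
theorem Sdel_delay_ODE (τ a b : ℝ) (hτ : 0 < τ) (n : ℕ) (t : ℝ)
    (ht : t ∈ Set.Ioo ((n : ℝ) * τ) (((n : ℝ) + 1) * τ)) :
    HasDerivAt (Sdel τ a b) (deriv (Sdel τ a b) t) t ∧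
    HasDerivAt (deriv (Sdel τ a b)) (a * Sdel τ a b t + b * Sdel τ a b (t - τ)) t := by
  refine ⟨(hasDerivAt_Sdel hτ a b n ht).differentiableAt.hasDerivAt, ?_⟩
  have hderiv : deriv (Sdel τ a b) =ᶠ[nhds t]
      fun s => ∑ k ∈ Finset.range (n + 1), evenSeries a b k (s - k * τ) := by
    filter_upwards [isOpen_Ioo.mem_nhds ht] with s hs
    exact (hasDerivAt_Sdel hτ a b n hs).deriv
  refine HasDerivAt.congr_of_eventuallyEq ?_ hderiv
  rw [Sdel_eq_sum hτ a b (n + 1) (by push_cast; linarith [ht.1]) (by push_cast; exact ht.2),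
    Sdel_eq_sum hτ a b n (by linarith [ht.1]) (by linarith [ht.2])]
  simp_rw [Finset.sum_range_succ' _ n]
  have hsum := (HasDerivAt.fun_sum (u := Finset.range n) fun k _ =>
    (hasDerivAt_evenSeries_succ a b k _).comp_sub_const t (((k + 1 : ℕ) : ℝ) * τ)).add
    ((hasDerivAt_evenSeries_zero a b _).comp_sub_const t (((0 : ℕ) : ℝ) * τ))
  refine hsum.congr_deriv ?_
  rw [Finset.sum_add_distrib, ← Finset.mul_sum, ← Finset.mul_sum]
  have hshift : ∀ k : ℕ, t - ((k + 1 : ℕ) : ℝ) * τ = t - τ - k * τ := fun k => by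
    push_cast
    ring
  simp_rw [hshift]
  ring
end

section
/- (Cauchy formula for the homogeneous delay problem.) Let φ ∈ C¹([-τ,0],ℝ). Define y₀ : [-τ,T] → ℝ by y₀(t) = φ(t) for t ∈ [-τ,0] and y₀(t) = C_τ^{a,b}(t)·φ(0) + S_τ^{a,b}(t)·φ'(0) + b·∫_{-τ}^{0} S_τ^{a,b}(t-τ-s)·φ(s) ds for t ∈ [0,T], where φ'(0) is the one-sided derivative at 0. Then y₀ is a stepwise solution of ÿ(t) = a·y(t) + b·y(t-τ) with history φ (i.e., with f ≡ 0). -/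
/-- Stepwise (piecewise-in-time) classical solution of the scalar delay equation
`ÿ(t) = a·y(t) + b·y(t-τ) + f(t)` on `[0, Nτ]` with history `φ` on `[-τ, 0]`:
`y` and its first derivative are continuous on `[-τ, Nτ]`; on each open step interval
`((k-1)τ, kτ)` the second derivative exists, is continuous, satisfies the equation
pointwise, and has finite one-sided limits at the endpoints; and `y = φ`, `y' = φ'`
on `[-τ, 0]`. -/
def StepwiseSolution (τ : ℝ) (N : ℕ) (a b : ℝ) (f φ y : ℝ → ℝ) : Prop :=
  ContinuousOn y (Set.Icc (-τ) ((N : ℝ) * τ)) ∧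
  DifferentiableOn ℝ y (Set.Icc (-τ) ((N : ℝ) * τ)) ∧
  ContinuousOn (derivWithin y (Set.Icc (-τ) ((N : ℝ) * τ))) (Set.Icc (-τ) ((N : ℝ) * τ)) ∧
  (∀ k : ℕ, 1 ≤ k → k ≤ N →
    (∀ t ∈ Set.Ioo (((k : ℝ) - 1) * τ) ((k : ℝ) * τ),
      HasDerivAt y (deriv y t) t ∧
      HasDerivAt (deriv y) (a * y t + b * y (t - τ) + f t) t) ∧
    ContinuousOn (deriv (deriv y)) (Set.Ioo (((k : ℝ) - 1) * τ) ((k : ℝ) * τ)) ∧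
    (∃ l : ℝ, Filter.Tendsto (deriv (deriv y))
      (nhdsWithin (((k : ℝ) - 1) * τ) (Set.Ioo (((k : ℝ) - 1) * τ) ((k : ℝ) * τ))) (nhds l)) ∧
    (∃ l : ℝ, Filter.Tendsto (deriv (deriv y))
      (nhdsWithin ((k : ℝ) * τ) (Set.Ioo (((k : ℝ) - 1) * τ) ((k : ℝ) * τ))) (nhds l))) ∧
  (∀ t ∈ Set.Icc (-τ) (0 : ℝ), y t = φ t ∧
    derivWithin y (Set.Icc (-τ) ((N : ℝ) * τ)) t = derivWithin φ (Set.Icc (-τ) (0 : ℝ)) t)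

/-- The term `v (k, m) (t - kτ)₊ ^ (2m + j) / (2m + j)!` of a delayed double power series. -/
noncomputable def delayTerm (τ : ℝ) (v : ℕ × ℕ → ℝ) (j : ℕ) (p : ℕ × ℕ) (t : ℝ) : ℝ :=
  v p * (max (t - (p.1 : ℝ) * τ) 0 ^ (2 * p.2 + j) / (Nat.factorial (2 * p.2 + j) : ℝ))

/-- The sum of the double series with terms `delayTerm`. -/
noncomputable def delaySeries (τ : ℝ) (v : ℕ × ℕ → ℝ) (j : ℕ) (t : ℝ) : ℝ :=
  ∑' p, delayTerm τ v j p t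

/-- Coefficients whose associated double series converges absolutely and locally uniformly. -/
def EntireCoeff (v : ℕ × ℕ → ℝ) : Prop :=
  ∀ M : ℝ, 0 ≤ M → Summable fun p => |v p| * (M ^ (2 * p.2) / (Nat.factorial (2 * p.2) : ℝ))

/-- The coefficients `binom(m, k) a ^ (m - k) b ^ k` of the delayed perturbation functions. -/
noncomputable def delayCoeff (a b : ℝ) (p : ℕ × ℕ) : ℝ :=
  (p.2.choose p.1 : ℝ) * a ^ (p.2 - p.1) * b ^ p.1

/-- Coefficients delayed by one step. -/
def delayShift (v : ℕ × ℕ → ℝ) (p : ℕ × ℕ) : ℝ :=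
  if p.1 = 0 then 0 else v (p.1 - 1, p.2)

theorem hasDerivAt_max_sub_pow (c : ℝ) (n : ℕ) (t : ℝ) :
    HasDerivAt (fun t : ℝ => max (t - c) 0 ^ (n + 2) / (Nat.factorial (n + 2) : ℝ))
      (max (t - c) 0 ^ (n + 1) / (Nat.factorial (n + 1) : ℝ)) t := by
  have hf : ((n + 2 : ℕ) : ℝ) * max (t - c) 0 ^ (n + 1) / (Nat.factorial (n + 2) : ℝ)
      = max (t - c) 0 ^ (n + 1) / (Nat.factorial (n + 1) : ℝ) := by
    rw [Nat.factorial_succ (n + 1)]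
    push_cast
    field_simp
    ring
  rw [← hf]
  refine HasDerivAt.div_const ?_ _
  rcases lt_trichotomy t c with h | h | h
  · have h0 : (fun t : ℝ => max (t - c) 0 ^ (n + 2)) =ᶠ[nhds t] fun _ => 0 := by
      filter_upwards [Iio_mem_nhds h] with x hx
      rw [max_eq_right (by linarith [Set.mem_Iio.1 hx])]
      simp
    rw [max_eq_right (by linarith)]
    simpa using (hasDerivAt_const t (0 : ℝ)).congr_of_eventuallyEq h0
  · subst h
    have h1 : HasDerivAt (fun x : ℝ => (x - t) ^ 2 * max (x - t) 0 ^ n)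
        (0 : ℝ) t := by
      rw [hasDerivAt_iff_isLittleO]
      have : (fun x : ℝ => (x - t) * max (x - t) 0 ^ n * (x - t)) =o[nhds t]
          fun x => (1 : ℝ) * (x - t) := by
        refine Asymptotics.IsLittleO.mul_isBigO ?_ (Asymptotics.isBigO_refl _ _)
        rw [Asymptotics.isLittleO_one_iff]
        have hc : Continuous fun x : ℝ => (x - t) * max (x - t) 0 ^ n := by fun_prop
        simpa using hc.tendsto t
      refine this.congr (fun x => ?_) (fun x => ?_)
      · simp; ring
      · simp
    have h2 : HasDerivAt (fun x : ℝ => max (x - t) 0 ^ (n + 2)) (0 : ℝ) t := by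
      rw [hasDerivAt_iff_isLittleO] at h1 ⊢
      refine Asymptotics.IsBigO.trans_isLittleO (Asymptotics.isBigO_of_le _ fun x => ?_) h1
      rcases le_total (x - t) 0 with h | h
      · simp [max_eq_right h, mul_nonneg, sq_nonneg]
      · simp [max_eq_left h, pow_add, mul_comm]
    simpa using h2
  · have h0 : (fun t : ℝ => max (t - c) 0 ^ (n + 2)) =ᶠ[nhds t] fun t => (t - c) ^ (n + 2) := by
      filter_upwards [Ioi_mem_nhds h] with x hx
      rw [max_eq_left (by linarith [Set.mem_Ioi.1 hx])]
    rw [max_eq_left (by linarith)]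
    have := ((hasDerivAt_id t).sub_const c).pow (n + 2)
    simpa using this.congr_of_eventuallyEq h0

theorem norm_delayTerm_le {τ : ℝ} (hτ : 0 ≤ τ) (v : ℕ × ℕ → ℝ) (j : ℕ) (p : ℕ × ℕ) {t M : ℝ}
    (ht : |t| ≤ M) :
    ‖delayTerm τ v j p t‖ ≤
      M ^ j * (|v p| * (M ^ (2 * p.2) / (Nat.factorial (2 * p.2) : ℝ))) := by
  have hM : 0 ≤ M := (abs_nonneg t).trans ht
  have hx : max (t - (p.1 : ℝ) * τ) 0 ≤ M :=
    max_le (by nlinarith [le_abs_self t, mul_nonneg (Nat.cast_nonneg (α := ℝ) p.1) hτ]) hM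
  have hx0 : 0 ≤ max (t - (p.1 : ℝ) * τ) 0 := le_max_right _ _
  have hfac : (Nat.factorial (2 * p.2) : ℝ) ≤ Nat.factorial (2 * p.2 + j) := by
    exact_mod_cast Nat.factorial_le (Nat.le_add_right _ _)
  have hpos : (0 : ℝ) < Nat.factorial (2 * p.2) := by positivity
  rw [delayTerm, Real.norm_eq_abs, abs_mul,
    abs_of_nonneg (a := _ / _) (by positivity)]
  calc |v p| * (max (t - (p.1 : ℝ) * τ) 0 ^ (2 * p.2 + j) / (Nat.factorial (2 * p.2 + j) : ℝ))
      ≤ |v p| * (M ^ (2 * p.2 + j) / (Nat.factorial (2 * p.2) : ℝ)) := by gcongr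
    _ = _ := by rw [pow_add]; ring

theorem EntireCoeff.summable {τ : ℝ} (hτ : 0 ≤ τ) {v : ℕ × ℕ → ℝ} (hv : EntireCoeff v) (j : ℕ)
    (t : ℝ) : Summable fun p => delayTerm τ v j p t :=
  Summable.of_norm_bounded ((hv |t| (abs_nonneg t)).mul_left (|t| ^ j))
    fun p => norm_delayTerm_le hτ v j p le_rfl

theorem EntireCoeff.hasDerivAt {τ : ℝ} (hτ : 0 ≤ τ) {v : ℕ × ℕ → ℝ} (hv : EntireCoeff v) (j : ℕ)
    (t : ℝ) : HasDerivAt (delaySeries τ v (j + 2)) (delaySeries τ v (j + 1) t) t := by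
  have hM : 0 ≤ |t| + 1 := by positivity
  refine hasDerivAt_tsum_of_isPreconnected (t := Set.Ioo (-(|t| + 1)) (|t| + 1)) (y₀ := t)
    (g := fun p t => delayTerm τ v (j + 2) p t) (g' := fun p t => delayTerm τ v (j + 1) p t)
    ((hv (|t| + 1) hM).mul_left ((|t| + 1) ^ (j + 1)))
    isOpen_Ioo isPreconnected_Ioo ?_ ?_ ?_ (hv.summable hτ _ _) ?_
  · intro p y _
    exact (hasDerivAt_max_sub_pow ((p.1 : ℝ) * τ) (2 * p.2 + j) y).const_mul (v p)
  · intro p y hy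
    exact norm_delayTerm_le hτ v _ p (abs_le.2 ⟨hy.1.le, hy.2.le⟩)
  all_goals exact abs_lt.1 (by linarith)

theorem EntireCoeff.continuous {τ : ℝ} (hτ : 0 ≤ τ) {v : ℕ × ℕ → ℝ} (hv : EntireCoeff v) (j : ℕ) :
    Continuous (delaySeries τ v (j + 2)) :=
  continuous_iff_continuousAt.2 fun t => (hv.hasDerivAt hτ j t).continuousAt

theorem delaySeries_of_nonpos {τ : ℝ} (hτ : 0 ≤ τ) (v : ℕ × ℕ → ℝ) (j : ℕ) {t : ℝ} (ht : t ≤ 0) :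
    delaySeries τ v (j + 1) t = 0 := by
  have : ∀ p, delayTerm τ v (j + 1) p t = 0 := fun p => by
    rw [delayTerm, max_eq_right (by nlinarith [mul_nonneg (Nat.cast_nonneg (α := ℝ) p.1) hτ])]
    simp [← add_assoc]
  simp [delaySeries, this]

theorem entireCoeff_delayCoeff (a b : ℝ) : EntireCoeff (delayCoeff a b) := by
  intro M hM
  rw [← (Equiv.prodComm ℕ ℕ).summable_iff]
  have hsum : ∀ m : ℕ, HasSum (fun k : ℕ => |delayCoeff a b (k, m)| *
      (M ^ (2 * m) / (Nat.factorial (2 * m) : ℝ)))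
      ((|a| + |b|) ^ m * (M ^ (2 * m) / (Nat.factorial (2 * m) : ℝ))) := fun m => by
    refine HasSum.mul_right _ ?_
    have hk : ∀ k ∉ Finset.range (m + 1), |delayCoeff a b (k, m)| = 0 := fun k hk => by
      have : m < k := by simpa [Nat.lt_succ_iff] using hk
      simp [delayCoeff, Nat.choose_eq_zero_of_lt this]
    have hs : (|a| + |b|) ^ m = ∑ k ∈ Finset.range (m + 1), |delayCoeff a b (k, m)| := by
      rw [add_comm |a|, add_pow]
      refine Finset.sum_congr rfl fun k _ => ?_
      simp only [delayCoeff, abs_mul, abs_pow, Nat.abs_cast]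
      ring
    rw [hs]
    exact hasSum_sum_of_ne_finset_zero hk
  refine (summable_prod_of_nonneg fun p => ?_).2 ⟨fun m => (hsum m).summable, ?_⟩
  · simp only [Function.comp, Pi.zero_apply]; positivity
  · have : (fun m : ℕ => ∑' k : ℕ, ((fun p : ℕ × ℕ => |delayCoeff a b p| *
        (M ^ (2 * p.2) / (Nat.factorial (2 * p.2) : ℝ))) ∘ (Equiv.prodComm ℕ ℕ)) (m, k))
        = fun m => (|a| + |b|) ^ m * (M ^ (2 * m) / (Nat.factorial (2 * m) : ℝ)) :=
      funext fun m => (hsum m).tsum_eq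
    rw [this]
    refine Summable.of_nonneg_of_le (fun m => by positivity) (fun m => ?_)
      (Real.summable_pow_div_factorial ((|a| + |b|) * M ^ 2))
    rw [mul_pow, ← pow_mul, mul_div_assoc]
    have : (Nat.factorial m : ℝ) ≤ Nat.factorial (2 * m) := by
      exact_mod_cast Nat.factorial_le (by omega)
    gcongr

theorem EntireCoeff.delayShift {v : ℕ × ℕ → ℝ} (hv : EntireCoeff v) :
    EntireCoeff (delayShift v) := by
  intro M hM
  have hi : Function.Injective fun p : ℕ × ℕ => (p.1 + 1, p.2) := fun p q h => by
    simpa [Prod.ext_iff] using h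
  rw [← hi.summable_iff]
  · exact hv M hM
  · rintro ⟨k, m⟩ hp
    obtain rfl : k = 0 := by
      by_contra hk
      exact hp ⟨(k - 1, m), by simp; omega⟩
    simp [_root_.delayShift]

theorem delaySeries_delayShift (τ : ℝ) (v : ℕ × ℕ → ℝ) (j : ℕ) (t : ℝ) :
    delaySeries τ (delayShift v) j t = delaySeries τ v j (t - τ) := by
  have hi : Function.Injective fun p : ℕ × ℕ => (p.1 + 1, p.2) := fun p q h => by
    simpa [Prod.ext_iff] using h
  rw [delaySeries, ← hi.tsum_eq, delaySeries]
  · refine tsum_congr fun p => ?_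
    simp only [delayTerm, delayShift, Nat.add_eq_zero_iff, one_ne_zero, and_false, if_false,
      Nat.add_sub_cancel]
    rw [show t - ((p.1 + 1 : ℕ) : ℝ) * τ = t - τ - (p.1 : ℝ) * τ by push_cast; ring]
  · rintro ⟨k, m⟩ hp
    cases k with
    | zero => simp [delayTerm, delayShift] at hp
    | succ k => exact ⟨(k, m), rfl⟩

theorem delayCoeff_succ (a b : ℝ) (k m : ℕ) :
    delayCoeff a b (k, m + 1) =
      a * delayCoeff a b (k, m) + b * delayShift (delayCoeff a b) (k, m) := by
  rcases k with _ | k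
  · simp [delayCoeff, delayShift, pow_succ']
  · simp only [delayCoeff, delayShift, Nat.add_sub_add_right, Nat.choose_succ_succ,
      Nat.add_eq_zero_iff, one_ne_zero, and_false, if_false, Nat.add_sub_cancel]
    push_cast
    rcases lt_or_ge k m with h | h
    · obtain ⟨d, rfl⟩ := Nat.exists_eq_add_of_lt h
      rw [show k + d + 1 - k = d + 1 by omega, show k + d + 1 - (k + 1) = d by omega]
      ring
    · rw [Nat.choose_eq_zero_of_lt (show m < k + 1 by omega)]
      simp; ring

/-- The coefficients of the second derivative of the delayed perturbation functions. -/
noncomputable def delayCoeffNext (a b : ℝ) (p : ℕ × ℕ) : ℝ :=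
  delayCoeff a b (p.1, p.2 + 1)

theorem entireCoeff_delayCoeffNext (a b : ℝ) : EntireCoeff (delayCoeffNext a b) := by
  intro M hM
  refine Summable.of_nonneg_of_le (fun p => by positivity) (fun p => ?_)
    (((entireCoeff_delayCoeff a b M hM).mul_left |a|).add
      (((entireCoeff_delayCoeff a b).delayShift M hM).mul_left |b|))
  rw [← mul_assoc, ← mul_assoc, ← add_mul, ← abs_mul, ← abs_mul, delayCoeffNext, delayCoeff_succ]
  gcongr
  exact abs_add_le _ _

theorem delaySeries_delayCoeffNext {τ : ℝ} (hτ : 0 ≤ τ) (a b : ℝ) (j : ℕ) (t : ℝ) :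
    delaySeries τ (delayCoeffNext a b) j t =
      a * delaySeries τ (delayCoeff a b) j t + b * delaySeries τ (delayCoeff a b) j (t - τ) := by
  have hc := entireCoeff_delayCoeff a b
  rw [← delaySeries_delayShift, delaySeries, delaySeries, delaySeries, ← tsum_mul_left,
    ← tsum_mul_left, ← ((hc.summable hτ j t).mul_left a).tsum_add
      ((hc.delayShift.summable hτ j t).mul_left b)]
  refine tsum_congr fun p => ?_
  simp only [delayTerm, delayCoeffNext, delayCoeff_succ]
  ring

theorem delaySeries_delayCoeff_eq {τ : ℝ} (hτ : 0 ≤ τ) (a b : ℝ) (j : ℕ) (t : ℝ) :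
    delaySeries τ (delayCoeff a b) j t =
      max t 0 ^ j / (Nat.factorial j : ℝ) + delaySeries τ (delayCoeffNext a b) (j + 2) t := by
  have hi : Function.Injective fun p : ℕ × ℕ => (p.1, p.2 + 1) := fun p q h => by
    simpa [Prod.ext_iff] using h
  rw [delaySeries, ((entireCoeff_delayCoeff a b).summable hτ j t).tsum_eq_add_tsum_ite (0, 0),
    ← hi.tsum_eq]
  · congr 1
    · simp [delayTerm, delayCoeff]
    · refine tsum_congr fun p => ?_
      simp only [Prod.mk.injEq, Nat.add_eq_zero_iff, one_ne_zero, and_false, if_false, delayTerm,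
        delayCoeffNext]
      rw [show 2 * (p.2 + 1) + j = 2 * p.2 + (j + 2) by ring]
  · rintro ⟨k, m⟩ hp
    cases m with
    | zero =>
      cases k with
      | zero => simp at hp
      | succ k => simp [delayTerm, delayCoeff] at hp
    | succ m => exact ⟨(k, m), rfl⟩

theorem Cterm_eq_delayTerm (τ a b t : ℝ) (k m : ℕ) :
    Cterm τ a b t k m = delayTerm τ (delayCoeff a b) 0 (k, m) t := by
  simp only [Cterm, delayTerm, delayCoeff, add_zero]
  split_ifs with h
  · ring
  · simp [Nat.choose_eq_zero_of_lt (not_le.1 h)]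

theorem Sterm_eq_delayTerm (τ a b t : ℝ) (k m : ℕ) :
    Sterm τ a b t k m = delayTerm τ (delayCoeff a b) 1 (k, m) t := by
  simp only [Sterm, delayTerm, delayCoeff]
  split_ifs with h
  · ring
  · simp [Nat.choose_eq_zero_of_lt (not_le.1 h)]

theorem Sdel_eq_delaySeries {τ : ℝ} (hτ : 0 ≤ τ) (a b : ℝ) (t : ℝ) :
    Sdel τ a b t = delaySeries τ (delayCoeff a b) 1 t := by
  rw [Sdel]
  split_ifs with h
  · exact (delaySeries_of_nonpos hτ _ 0 h.le).symm
  · simp_rw [Sterm_eq_delayTerm]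
    exact ((entireCoeff_delayCoeff a b).summable hτ 1 t).tsum_prod.symm

theorem Cdel_eq_add {τ : ℝ} (hτ : 0 ≤ τ) (a b : ℝ) (t : ℝ) :
    Cdel τ a b t = (if t < 0 then 0 else 1) + delaySeries τ (delayCoeffNext a b) 2 t := by
  rw [Cdel]
  split_ifs with h
  · rw [delaySeries_of_nonpos hτ _ 1 h.le, add_zero]
  · simp_rw [Cterm_eq_delayTerm]
    rw [← ((entireCoeff_delayCoeff a b).summable hτ 0 t).tsum_prod]
    simpa [delaySeries] using delaySeries_delayCoeff_eq hτ a b 0 t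

theorem Sdel_eq_add {τ : ℝ} (hτ : 0 ≤ τ) (a b : ℝ) (t : ℝ) :
    Sdel τ a b t = max t 0 + delaySeries τ (delayCoeffNext a b) 3 t := by
  rw [Sdel_eq_delaySeries hτ, delaySeries_delayCoeff_eq hτ]
  simp

theorem hasDerivAt_integral_comp_sub_mul {g g' h : ℝ → ℝ} (hg : ∀ u, HasDerivAt g (g' u) u)
    (hg' : Continuous g') (hh : Continuous h) (c d x : ℝ) :
    HasDerivAt (fun x => ∫ s in c..d, g (x - s) * h s) (∫ s in c..d, g' (x - s) * h s) x := by
  have hgc : Continuous g := continuous_iff_continuousAt.2 fun u => (hg u).continuousAt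
  have hK : IsCompact (Metric.closedBall x 1 ×ˢ Set.uIcc c d) :=
    (isCompact_closedBall x 1).prod isCompact_uIcc
  obtain ⟨K, hK⟩ := hK.exists_bound_of_continuousOn
    (f := fun q : ℝ × ℝ => g' (q.1 - q.2) * h q.2) (by fun_prop)
  refine (intervalIntegral.hasDerivAt_integral_of_dominated_loc_of_deriv_le
    (F := fun x s => g (x - s) * h s) (F' := fun x s => g' (x - s) * h s)
    (bound := fun _ => K) (Metric.ball_mem_nhds x one_pos)
    (.of_forall fun y => Continuous.aestronglyMeasurable (by fun_prop))
    (Continuous.intervalIntegrable (by fun_prop) _ _)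
    (Continuous.aestronglyMeasurable (by fun_prop)) (.of_forall fun s hs y hy => ?_)
    intervalIntegrable_const (.of_forall fun s _ y _ => ?_)).2
  · exact hK (y, s) ⟨Metric.ball_subset_closedBall hy, Set.uIoc_subset_uIcc hs⟩
  · exact ((hg (y - s)).comp_sub_const y s).mul_const (h s)

theorem hasDerivAt_integral_max_sub_mul {h : ℝ → ℝ} (hh : Continuous h) {c d : ℝ} (hcd : c ≤ d)
    (x : ℝ) :
    HasDerivAt (fun x => ∫ s in c..d, max (x - s) 0 * h s)
      (∫ s in c..max c (min d x), h s) x := by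
  have hi : ∫ s in c..max c (min d x), h s = ∫ s in c..d, (Set.Iic x).indicator h s := by
    rw [intervalIntegral.integral_of_le (le_max_left _ _), intervalIntegral.integral_of_le hcd,
      MeasureTheory.setIntegral_indicator measurableSet_Iic, Set.Ioc_inter_Iic]
    congr 2
    ext s
    simp only [Set.mem_Ioc, le_max_iff]
    grind
  rw [hi]
  refine (intervalIntegral.hasDerivAt_integral_of_dominated_loc_of_lip
    (F := fun x s => max (x - s) 0 * h s) (bound := fun s => |h s|) Filter.univ_mem
    (.of_forall fun y => Continuous.aestronglyMeasurable (by fun_prop))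
    (Continuous.intervalIntegrable (by fun_prop) _ _)
    (hh.measurable.indicator measurableSet_Iic).aestronglyMeasurable
    (.of_forall fun s _ => ?_) (Continuous.intervalIntegrable (by fun_prop) _ _) ?_).2
  · refine LipschitzOnWith.of_dist_le_mul fun y _ z _ => ?_
    simp only [Real.dist_eq, Real.coe_nnabs, abs_abs, ← sub_mul, abs_mul]
    rw [mul_comm]
    refine mul_le_mul_of_nonneg_left ?_ (abs_nonneg _)
    exact (abs_max_sub_max_le_abs (y - s) (z - s) 0).trans_eq (by rw [sub_sub_sub_cancel_right])
  · filter_upwards [MeasureTheory.Measure.ae_ne MeasureTheory.volume x] with s hs _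
    rcases lt_or_gt_of_ne hs with h1 | h1
    · rw [Set.indicator_of_mem (Set.mem_Iic.2 h1.le)]
      have h2 : HasDerivAt (fun y => (y - s) * h s) (1 * h s) x :=
        ((hasDerivAt_id x).sub_const s).mul_const (h s)
      rw [one_mul] at h2
      refine h2.congr_of_eventuallyEq ?_
      filter_upwards [Ioi_mem_nhds h1] with y hy
      rw [max_eq_left (by linarith [Set.mem_Ioi.1 hy])]
    · rw [Set.indicator_of_notMem (by simpa using h1)]
      refine (hasDerivAt_const x (0 : ℝ)).congr_of_eventuallyEq ?_
      filter_upwards [Iio_mem_nhds h1] with y hy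
      rw [max_eq_right (by linarith [Set.mem_Iio.1 hy]), zero_mul]

theorem Cdel_of_neg (τ a b : ℝ) {t : ℝ} (ht : t < 0) : Cdel τ a b t = 0 :=
  if_pos ht

theorem Sdel_of_neg (τ a b : ℝ) {t : ℝ} (ht : t < 0) : Sdel τ a b t = 0 :=
  if_pos ht

theorem hasDerivAt_delaySeries_delayCoeffNext {τ : ℝ} (hτ : 0 ≤ τ) (a b t : ℝ) :
    HasDerivAt (delaySeries τ (delayCoeffNext a b) 2)
      (a * Sdel τ a b t + b * Sdel τ a b (t - τ)) t := by
  have := (entireCoeff_delayCoeffNext a b).hasDerivAt hτ 0 t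
  rwa [delaySeries_delayCoeffNext hτ, ← Sdel_eq_delaySeries hτ, ← Sdel_eq_delaySeries hτ] at this

theorem continuous_Sdel {τ : ℝ} (hτ : 0 ≤ τ) (a b : ℝ) : Continuous (Sdel τ a b) := by
  have h3 := (entireCoeff_delayCoeffNext a b).continuous hτ 1
  rw [funext (Sdel_eq_add hτ a b)]
  fun_prop

theorem hasDerivAt_Sdel_s7 {τ : ℝ} (hτ : 0 ≤ τ) (a b : ℝ) {t : ℝ} (ht : t ≠ 0) :
    HasDerivAt (Sdel τ a b) (Cdel τ a b t) t := by
  rw [funext (Sdel_eq_add hτ a b), Cdel_eq_add hτ]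
  refine HasDerivAt.add ?_ ((entireCoeff_delayCoeffNext a b).hasDerivAt hτ 1 t)
  rcases lt_or_gt_of_ne ht with h | h
  · rw [if_pos h]
    refine (hasDerivAt_const t (0 : ℝ)).congr_of_eventuallyEq ?_
    filter_upwards [Iio_mem_nhds h] with x hx using max_eq_right (le_of_lt hx)
  · rw [if_neg (not_lt.2 h.le)]
    refine (hasDerivAt_id t).congr_of_eventuallyEq ?_
    filter_upwards [Ioi_mem_nhds h] with x hx using max_eq_left (le_of_lt hx)

/-- The contribution of the history `h` to the Cauchy formula. -/
noncomputable def delayHistoryIntegral (τ a b : ℝ) (h : ℝ → ℝ) (t : ℝ) : ℝ :=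
  ∫ s in (-τ)..(0 : ℝ), Sdel τ a b (t - τ - s) * h s

/-- The derivative of `delayHistoryIntegral`. -/
noncomputable def delayHistoryIntegralDeriv (τ a b : ℝ) (h : ℝ → ℝ) (t : ℝ) : ℝ :=
  (∫ s in (-τ)..max (-τ) (min 0 (t - τ)), h s) +
    ∫ s in (-τ)..(0 : ℝ), delaySeries τ (delayCoeffNext a b) 2 (t - τ - s) * h s

theorem delayHistoryIntegral_of_nonpos {τ : ℝ} (hτ : 0 ≤ τ) (a b : ℝ) (h : ℝ → ℝ) {t : ℝ}
    (ht : t ≤ 0) : delayHistoryIntegral τ a b h t = 0 := by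
  refine (intervalIntegral.integral_congr (g := fun _ => 0) fun s hs => ?_).trans (by simp)
  rw [Set.uIcc_of_le (by linarith)] at hs
  simp only
  rw [Sdel_eq_delaySeries hτ, delaySeries_of_nonpos hτ _ 0 (by linarith [hs.1]), zero_mul]

theorem delayHistoryIntegralDeriv_of_nonpos {τ : ℝ} (hτ : 0 ≤ τ) (a b : ℝ) (h : ℝ → ℝ) {t : ℝ}
    (ht : t ≤ 0) : delayHistoryIntegralDeriv τ a b h t = 0 := by
  rw [delayHistoryIntegralDeriv, max_eq_left (min_le_of_right_le (by linarith)),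
    intervalIntegral.integral_same, zero_add]
  refine (intervalIntegral.integral_congr (g := fun _ => 0) fun s hs => ?_).trans (by simp)
  rw [Set.uIcc_of_le (by linarith)] at hs
  simp only
  rw [delaySeries_of_nonpos hτ _ 1 (by linarith [hs.1]), zero_mul]

theorem hasDerivAt_delayHistoryIntegral {τ : ℝ} (hτ : 0 ≤ τ) (a b : ℝ) {h : ℝ → ℝ}
    (hh : Continuous h) (t : ℝ) :
    HasDerivAt (delayHistoryIntegral τ a b h) (delayHistoryIntegralDeriv τ a b h t) t := by
  have hv := entireCoeff_delayCoeffNext a b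
  have hQ := hv.continuous hτ 1
  have h1 := hasDerivAt_integral_max_sub_mul hh (neg_nonpos.2 hτ) (t - τ)
  have h2 := hasDerivAt_integral_comp_sub_mul (hv.hasDerivAt hτ 1) (hv.continuous hτ 0) hh
    (-τ) 0 (t - τ)
  refine ((h1.add h2).comp_sub_const t τ).congr_of_eventuallyEq (.of_forall fun x => ?_)
  simp only [Pi.add_apply]
  rw [← intervalIntegral.integral_add (Continuous.intervalIntegrable (by fun_prop) _ _)
    (Continuous.intervalIntegrable (by fun_prop) _ _), delayHistoryIntegral]
  simp only [Sdel_eq_add hτ, add_mul]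

theorem hasDerivAt_integral_delaySeries_mul {τ : ℝ} (hτ : 0 ≤ τ) (a b : ℝ) {h : ℝ → ℝ}
    (hh : Continuous h) (t : ℝ) :
    HasDerivAt (fun t => ∫ s in (-τ)..(0 : ℝ),
        delaySeries τ (delayCoeffNext a b) 2 (t - τ - s) * h s)
      (a * delayHistoryIntegral τ a b h t + b * delayHistoryIntegral τ a b h (t - τ)) t := by
  have hS := continuous_Sdel hτ a b
  have h2 := hasDerivAt_integral_comp_sub_mul (hasDerivAt_delaySeries_delayCoeffNext hτ a b)
    (by fun_prop) hh (-τ) 0 (t - τ)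
  refine (h2.comp_sub_const t τ).congr_deriv ?_
  rw [delayHistoryIntegral, delayHistoryIntegral, ← intervalIntegral.integral_const_mul,
    ← intervalIntegral.integral_const_mul,
    ← intervalIntegral.integral_add (Continuous.intervalIntegrable (by fun_prop) _ _)
    (Continuous.intervalIntegrable (by fun_prop) _ _)]
  refine intervalIntegral.integral_congr fun s _ => ?_
  rw [show t - τ - s - τ = t - τ - τ - s by ring]
  ring

theorem continuous_delayHistoryIntegralDeriv {τ : ℝ} (hτ : 0 ≤ τ) (a b : ℝ) {h : ℝ → ℝ}
    (hh : Continuous h) : Continuous (delayHistoryIntegralDeriv τ a b h) := by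
  have h1 : Continuous fun x => ∫ s in (-τ)..x, h s :=
    intervalIntegral.continuous_primitive (fun _ _ => hh.intervalIntegrable _ _) _
  refine Continuous.add (h1.comp (g := fun x => ∫ s in (-τ)..x, h s)
    (f := fun t => max (-τ) (min 0 (t - τ))) (by fun_prop)) ?_
  exact continuous_iff_continuousAt.2 fun t =>
    (hasDerivAt_integral_delaySeries_mul hτ a b hh t).continuousAt

theorem hasDerivAt_delayHistoryIntegralDeriv {τ : ℝ} (hτ : 0 < τ) (a b : ℝ) {h : ℝ → ℝ}
    (hh : Continuous h) {t : ℝ} (ht : 0 < t) (hne : t ≠ τ) :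
    HasDerivAt (delayHistoryIntegralDeriv τ a b h)
      ((if t < τ then h (t - τ) else 0) +
        (a * delayHistoryIntegral τ a b h t + b * delayHistoryIntegral τ a b h (t - τ))) t := by
  refine HasDerivAt.add ?_ (hasDerivAt_integral_delaySeries_mul hτ.le a b hh t)
  rcases lt_or_gt_of_ne hne with h1 | h1
  · rw [if_pos h1]
    have h2 : HasDerivAt (fun t => ∫ s in (-τ)..(t - τ), h s) (h (t - τ)) t :=
      (intervalIntegral.integral_hasDerivAt_right (hh.intervalIntegrable _ _)
        (hh.stronglyMeasurableAtFilter _ _) hh.continuousAt).comp_sub_const t τ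
    refine h2.congr_of_eventuallyEq ?_
    filter_upwards [Ioo_mem_nhds ht h1] with x hx
    rw [min_eq_right (by linarith [hx.2]), max_eq_right (by linarith [hx.1])]
  · rw [if_neg (not_lt.2 h1.le)]
    refine (hasDerivAt_const t (∫ s in (-τ)..(0 : ℝ), h s)).congr_of_eventuallyEq ?_
    filter_upwards [Ioi_mem_nhds h1] with x hx
    rw [min_eq_left (by linarith [Set.mem_Ioi.1 hx]), max_eq_right (by linarith)]

theorem hasDerivWithinAt_Icc_glue {y f g : ℝ → ℝ} {l m r : ℝ} (hlm : l ≤ m) (hmr : m ≤ r)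
    (hf : ∀ t ∈ Set.Icc l m, HasDerivWithinAt y (f t) (Set.Icc l m) t)
    (hg : ∀ t ∈ Set.Icc m r, HasDerivWithinAt y (g t) (Set.Icc m r) t) (hfg : f m = g m) :
    ∀ t ∈ Set.Icc l r, HasDerivWithinAt y (if t ≤ m then f t else g t) (Set.Icc l r) t := by
  intro t ht
  rcases lt_trichotomy t m with h | rfl | h
  · rw [if_pos h.le]
    refine (hf t ⟨ht.1, h.le⟩).mono_of_mem_nhdsWithin ?_
    filter_upwards [self_mem_nhdsWithin, mem_nhdsWithin_of_mem_nhds (Iio_mem_nhds h)]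
      with x hx hx' using ⟨hx.1, le_of_lt hx'⟩
  · rw [if_pos le_rfl, ← Set.Icc_union_Icc_eq_Icc hlm hmr]
    exact (hf t ⟨hlm, le_rfl⟩).union (hfg ▸ hg t ⟨le_rfl, hmr⟩)
  · rw [if_neg (not_le.2 h)]
    refine (hg t ⟨h.le, ht.2⟩).mono_of_mem_nhdsWithin ?_
    filter_upwards [self_mem_nhdsWithin, mem_nhdsWithin_of_mem_nhds (Ioi_mem_nhds h)]
      with x hx hx' using ⟨le_of_lt hx', hx.2⟩

/-- Cauchy formula for the homogeneous delay problem: if `φ ∈ C¹([-τ,0])`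
and `y₀` equals `φ` on `[-τ,0]` and equals
`C_τ^{a,b}(t)·φ(0) + S_τ^{a,b}(t)·φ'(0) + b·∫_{-τ}^0 S_τ^{a,b}(t-τ-s)·φ(s) ds` on `[0,T]`
(`T = Nτ`), then `y₀` is a stepwise solution of `ÿ = a·y(t) + b·y(t-τ)` with history `φ`. -/
theorem cauchy_formula_homogeneous (τ : ℝ) (hτ : 0 < τ) (N : ℕ) (a b : ℝ)
    (φ : ℝ → ℝ) (hφ : ContDiffOn ℝ 1 φ (Set.Icc (-τ) 0))
    (y₀ : ℝ → ℝ)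
    (hist : ∀ t ∈ Set.Icc (-τ) (0 : ℝ), y₀ t = φ t)
    (formula : ∀ t ∈ Set.Icc (0 : ℝ) ((N : ℝ) * τ),
      y₀ t = Cdel τ a b t * φ 0
        + Sdel τ a b t * derivWithin φ (Set.Icc (-τ) (0 : ℝ)) 0
        + b * ∫ s in (-τ)..(0 : ℝ), Sdel τ a b (t - τ - s) * φ s) :
    StepwiseSolution τ N a b (fun _ => 0) φ y₀ := by
  have hτ0 : -τ ≤ 0 := by linarith
  have hT : (0 : ℝ) ≤ (N : ℝ) * τ := by positivity
  set p := derivWithin φ (Set.Icc (-τ) (0 : ℝ)) 0 with hp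
  obtain ⟨h, hh, hhφ⟩ : ∃ h : ℝ → ℝ, Continuous h ∧ ∀ s ∈ Set.Icc (-τ) (0 : ℝ), h s = φ s :=
    ⟨fun s => φ (max (-τ) (min 0 s)), hφ.continuousOn.comp_continuous (by fun_prop)
      fun s => ⟨le_max_left _ _, max_le hτ0 (min_le_left _ _)⟩,
      fun s hs => by simp only [min_eq_right hs.2, max_eq_right hs.1]⟩
  have hy : ∀ t ∈ Set.Icc (0 : ℝ) ((N : ℝ) * τ), y₀ t = Cdel τ a b t * φ 0 + Sdel τ a b t * p
      + b * delayHistoryIntegral τ a b h t := fun t ht => by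
    rw [formula t ht, delayHistoryIntegral]
    congr 2
    refine intervalIntegral.integral_congr fun s hs => ?_
    rw [Set.uIcc_of_le hτ0] at hs
    simp only [hhφ s hs]
  set P := delaySeries τ (delayCoeffNext a b) 2
  set Q := delaySeries τ (delayCoeffNext a b) 3
  set J := delayHistoryIntegral τ a b h with hJ
  set Z : ℝ → ℝ := fun t => (1 + P t) * φ 0 + (t + Q t) * p + b * J t
  set Z' : ℝ → ℝ := fun t => (a * Sdel τ a b t + b * Sdel τ a b (t - τ)) * φ 0 + (1 + P t) * p
    + b * delayHistoryIntegralDeriv τ a b h t with hZ'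
  have hyZ : ∀ t ∈ Set.Icc (0 : ℝ) ((N : ℝ) * τ), y₀ t = Z t := fun t ht => by
    rw [hy t ht, Cdel_eq_add hτ.le, Sdel_eq_add hτ.le, if_neg (not_lt.2 ht.1), max_eq_left ht.1]
  have hPd := hasDerivAt_delaySeries_delayCoeffNext hτ.le a b
  have hQd : ∀ t, HasDerivAt Q (P t) t := (entireCoeff_delayCoeffNext a b).hasDerivAt hτ.le 1
  have hPc : Continuous P := (entireCoeff_delayCoeffNext a b).continuous hτ.le 0
  have hSc := continuous_Sdel hτ.le a b
  have hZd : ∀ t, HasDerivAt Z (Z' t) t := fun t =>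
    ((((hPd t).const_add 1).mul_const (φ 0)).add
      (((hasDerivAt_id t).add (hQd t)).mul_const p)).add
      ((hasDerivAt_delayHistoryIntegral hτ.le a b hh t).const_mul b)
  have hZ'c : Continuous Z' := by
    have := continuous_delayHistoryIntegralDeriv hτ.le a b hh
    fun_prop
  have hZ'0 : Z' 0 = p := by
    have h1 : Sdel τ a b 0 = 0 := by
      rw [Sdel_eq_delaySeries hτ.le, delaySeries_of_nonpos hτ.le _ 0 le_rfl]
    have h2 : Sdel τ a b (-τ) = 0 := by
      rw [Sdel_eq_delaySeries hτ.le, delaySeries_of_nonpos hτ.le _ 0 (by linarith)]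
    have h3 : P 0 = 0 := delaySeries_of_nonpos hτ.le _ 1 le_rfl
    simp [hZ', h1, h2, h3, delayHistoryIntegralDeriv_of_nonpos hτ.le a b h le_rfl]
  have hφd : ∀ t ∈ Set.Icc (-τ) (0 : ℝ), HasDerivWithinAt y₀
      (derivWithin φ (Set.Icc (-τ) 0) t) (Set.Icc (-τ) 0) t := fun t ht =>
    ((hφ.differentiableOn one_ne_zero t ht).hasDerivWithinAt).congr hist (hist t ht)
  have hZw : ∀ t ∈ Set.Icc (0 : ℝ) ((N : ℝ) * τ), HasDerivWithinAt y₀ (Z' t)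
      (Set.Icc 0 ((N : ℝ) * τ)) t := fun t ht =>
    (hZd t).hasDerivWithinAt.congr hyZ (hyZ t ht)
  have hd := hasDerivWithinAt_Icc_glue hτ0 hT hφd hZw hZ'0.symm
  have hu : UniqueDiffOn ℝ (Set.Icc (-τ) ((N : ℝ) * τ)) := uniqueDiffOn_Icc (by linarith)
  have hdw : ∀ t ∈ Set.Icc (-τ) ((N : ℝ) * τ), derivWithin y₀ (Set.Icc (-τ) ((N : ℝ) * τ)) t =
      if t ≤ 0 then derivWithin φ (Set.Icc (-τ) 0) t else Z' t := fun t ht =>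
    (hd t ht).derivWithin (hu t ht)
  have hyc : ContinuousOn y₀ (Set.Icc (-τ) ((N : ℝ) * τ)) := fun t ht =>
    (hd t ht).continuousWithinAt
  refine ⟨hyc, fun t ht => (hd t ht).differentiableWithinAt, ?_, fun k hk hkN => ?_,
    fun t ht => ⟨hist t ht, ?_⟩⟩
  · refine ContinuousOn.congr ?_ hdw
    rw [← Set.Icc_union_Icc_eq_Icc hτ0 hT]
    refine ContinuousOn.union_of_isClosed ?_ ?_ isClosed_Icc isClosed_Icc
    · exact (hφ.continuousOn_derivWithin (uniqueDiffOn_Icc (by linarith)) le_rfl).congr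
        fun t ht => if_pos ht.2
    · refine hZ'c.continuousOn.congr fun t ht => ?_
      rcases ht.1.eq_or_lt with h0 | h0
      · subst h0
        simp [hZ'0, hp]
      · exact if_neg (not_le.2 h0)
  · have hk1 : (1 : ℝ) ≤ k := by exact_mod_cast hk
    have hkT : (k : ℝ) * τ ≤ N * τ := by gcongr
    have hk0 : 0 ≤ ((k : ℝ) - 1) * τ := mul_nonneg (by linarith) hτ.le
    have hlt : ((k : ℝ) - 1) * τ < k * τ := by linarith
    have hnear : ∀ t ∈ Set.Ioo (((k : ℝ) - 1) * τ) ((k : ℝ) * τ), y₀ =ᶠ[nhds t] Z :=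
      fun t ht => by
        filter_upwards [isOpen_Ioo.mem_nhds ht] with x hx
        exact hyZ x ⟨hk0.trans hx.1.le, hx.2.le.trans hkT⟩
    have hy' : ∀ t ∈ Set.Ioo (((k : ℝ) - 1) * τ) ((k : ℝ) * τ), HasDerivAt y₀ (Z' t) t :=
      fun t ht => (hZd t).congr_of_eventuallyEq (hnear t ht)
    have hy'' : ∀ t ∈ Set.Ioo (((k : ℝ) - 1) * τ) ((k : ℝ) * τ),
        HasDerivAt (deriv y₀) (a * y₀ t + b * y₀ (t - τ)) t := fun t ht => by
      have ht0 : 0 < t := hk0.trans_lt ht.1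
      have htT : t ≤ N * τ := ht.2.le.trans hkT
      have hne : t ≠ τ := by
        rintro rfl
        have h1 : (k : ℝ) - 1 < 1 := by nlinarith [ht.1]
        have h2 : 1 < (k : ℝ) := by nlinarith [ht.2]
        have h3 : k < 2 := by exact_mod_cast (by linarith : (k : ℝ) < 2)
        have h4 : 1 < k := by exact_mod_cast h2
        omega
      have hev : deriv y₀ =ᶠ[nhds t] Z' := by
        filter_upwards [isOpen_Ioo.mem_nhds ht] with x hx using (hy' x hx).deriv
      refine HasDerivAt.congr_of_eventuallyEq ?_ hev
      have hS := hasDerivAt_Sdel_s7 hτ.le a b ht0.ne'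
      have hSτ := (hasDerivAt_Sdel_s7 hτ.le a b (sub_ne_zero.2 hne)).comp_sub_const t τ
      have hJd := hasDerivAt_delayHistoryIntegralDeriv hτ a b hh ht0 hne
      have hmain := ((((hS.const_mul a).add (hSτ.const_mul b)).mul_const (φ 0)).add
        (((hPd t).const_add 1).mul_const p)).add (hJd.const_mul b)
      refine hmain.congr_deriv ?_
      rw [hy t ⟨ht0.le, htT⟩]
      rcases lt_or_gt_of_ne hne with h1 | h1
      · have hmem : t - τ ∈ Set.Icc (-τ) (0 : ℝ) := ⟨by linarith, by linarith⟩
        rw [hist _ hmem, ← hhφ _ hmem, if_pos h1, hJ,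
          delayHistoryIntegral_of_nonpos hτ.le a b h hmem.2, Cdel_of_neg τ a b (sub_neg.2 h1),
          Sdel_of_neg τ a b (sub_neg.2 h1)]
        ring
      · rw [hy (t - τ) ⟨by linarith, by linarith⟩, if_neg (not_lt.2 h1.le)]
        ring
    have hyk : ContinuousOn y₀ (Set.Icc (((k : ℝ) - 1) * τ) ((k : ℝ) * τ)) :=
      hyc.mono (Set.Icc_subset_Icc (by linarith) hkT)
    have hyk' : ContinuousOn (fun t => y₀ (t - τ)) (Set.Icc (((k : ℝ) - 1) * τ) ((k : ℝ) * τ)) :=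
      hyc.comp (by fun_prop) fun t ht => ⟨by linarith [ht.1], by linarith [ht.2]⟩
    have hR : ContinuousOn (fun t => a * y₀ t + b * y₀ (t - τ))
        (Set.Icc (((k : ℝ) - 1) * τ) ((k : ℝ) * τ)) :=
      (continuousOn_const.mul hyk).add (continuousOn_const.mul hyk')
    have hRd : Set.EqOn (deriv (deriv y₀)) (fun t => a * y₀ t + b * y₀ (t - τ))
        (Set.Ioo (((k : ℝ) - 1) * τ) ((k : ℝ) * τ)) := fun t ht => (hy'' t ht).deriv
    have hlim : ∀ x ∈ Set.Icc (((k : ℝ) - 1) * τ) ((k : ℝ) * τ), ∃ l : ℝ,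
        Filter.Tendsto (deriv (deriv y₀))
          (nhdsWithin x (Set.Ioo (((k : ℝ) - 1) * τ) ((k : ℝ) * τ))) (nhds l) := fun x hx =>
      ⟨_, (((hR x hx).mono Set.Ioo_subset_Icc_self).tendsto).congr'
        (Filter.eventuallyEq_of_mem self_mem_nhdsWithin hRd.symm)⟩
    refine ⟨fun t ht => ⟨(hy' t ht).differentiableAt.hasDerivAt, ?_⟩,
      (hR.mono Set.Ioo_subset_Icc_self).congr hRd,
      hlim _ (Set.left_mem_Icc.2 hlt.le), hlim _ (Set.right_mem_Icc.2 hlt.le)⟩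
    simpa using hy'' t ht
  · rw [hdw t ⟨ht.1, ht.2.trans hT⟩, if_pos ht.2]
end
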